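/- Let p be an odd prime, i, k ∈ ℕ with k ≤ p−1, and G a finite p-group. Then the word ω = x^{p^i}[y₁,…,y_k] is interchangeable in G; that is, for every normal subgroup N of G, [ω(N), G] ≤ [N, ω(G)] · [ω(G), G]^p · [ω(G), G, G]. -/

import Mathlib

/-- The subgroup generated by `n`-th powers of elements of `H`. -/
def powSubgroup {G : Type*} [Group G] (H : Subgroup G) (n : ℕ) : Subgroup G :=
  Subgroup.closure {x | ∃ h ∈ H, h ^ n = x}

/-- The lower central series of a subgroup `H ≤ G`, as subgroups of `G`:
`gammaSub H m = γ_{m+1}(H)`. -/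
def gammaSub {G : Type*} [Group G] (H : Subgroup G) : ℕ → Subgroup G
  | 0 => H
  | m + 1 => ⁅gammaSub H m, H⁆

/-- The value `ω(H) = H^{p^i} γ_k(H)` of the word `ω = x^{p^i}[y₁,…,y_k]`. -/
def omegaI {G : Type*} [Group G] (p i k : ℕ) (H : Subgroup G) : Subgroup G :=
  powSubgroup H (p ^ i) ⊔ gammaSub H (k - 1)

open Subgroup
open scoped commutatorElement

section PolynomialSequences

variable {G : Type*} [Group G]

/-- The multiplicative difference `t ↦ (g t)⁻¹ * g (t + 1)` of a sequence in a group. -/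
def fwdRatio (g : ℕ → G) : ℕ → G := fun t => (g t)⁻¹ * g (t + 1)

/-- Polynomial sequences of level `m` with respect to a filtration `F`: the `r`-th iterated
difference takes values in `F (m + r)`. -/
def IsPolySeq (F : ℕ → Subgroup G) (m : ℕ) (g : ℕ → G) : Prop :=
  ∀ r t, (fwdRatio^[r] g) t ∈ F (m + r)

variable {F : ℕ → Subgroup G}

theorem isPolySeq_iff {m : ℕ} {g : ℕ → G} :
    IsPolySeq F m g ↔ (∀ t, g t ∈ F m) ∧ IsPolySeq F (m + 1) (fwdRatio g) := by
  constructor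
  · refine fun h => ⟨fun t => h 0 t, fun r t => ?_⟩
    have := h (r + 1) t
    rwa [Function.iterate_succ_apply, ← add_assoc, add_right_comm] at this
  · rintro ⟨h0, h1⟩ (_ | r) t
    · exact h0 t
    · have := h1 r t
      rwa [Function.iterate_succ_apply, ← add_assoc, add_right_comm]

theorem IsPolySeq.mono (hF : Antitone F) {m n : ℕ} (hmn : m ≤ n) {g : ℕ → G}
    (h : IsPolySeq F n g) : IsPolySeq F m g :=
  fun r t => hF (by omega) (h r t)

theorem isPolySeq_one (m : ℕ) : IsPolySeq F m (1 : ℕ → G) := by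
  intro r t
  have h : fwdRatio (1 : ℕ → G) = 1 := by
    funext t
    simp [fwdRatio]
  rw [Function.iterate_fixed h]
  exact one_mem _

theorem IsPolySeq.eq_one (hF : Antitone F) {s m : ℕ} (hs : F s = ⊥) (hm : s ≤ m) {g : ℕ → G}
    (h : IsPolySeq F m g) : g = 1 := by
  funext t
  have := hF hm (h 0 t)
  rwa [hs, mem_bot] at this

theorem isPolySeq_pow_choose (hF : Antitone F) {c : G} (l m : ℕ) (hc : c ∈ F (m + l)) :
    IsPolySeq F m (fun t => c ^ t.choose l) := by
  induction l generalizing m with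
  | zero =>
    refine isPolySeq_iff.2 ⟨fun t => pow_mem hc _, ?_⟩
    convert isPolySeq_one (F := F) (m + 1) using 1
    funext t
    simp [fwdRatio]
  | succ l ih =>
    refine isPolySeq_iff.2 ⟨fun t => pow_mem (hF (by omega) hc) _, ?_⟩
    convert ih (m + 1) (hF (by omega) hc) using 1
    funext t
    simp only [fwdRatio]
    rw [Nat.choose_succ_succ', add_comm (t.choose l), pow_add, inv_mul_cancel_left]

theorem iterate_fwdRatio_eq {f : ℕ → G} (r t : ℕ) (h : ∀ u < t + r, f u = 1) :
    (fwdRatio^[r] f) t = f (t + r) := by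
  induction r generalizing t with
  | zero => rfl
  | succ r ih =>
    rw [Function.iterate_succ_apply']
    simp only [fwdRatio]
    rw [ih t (fun u hu => h u (by omega)), ih (t + 1) (fun u hu => h u (by omega)),
      h (t + r) (by omega), inv_one, one_mul]
    congr 1
    omega

theorem IsPolySeq.eq_one_of_forall_lt {s : ℕ} (hs : F s = ⊥) {f : ℕ → G}
    (hf : IsPolySeq F 0 f) (h : ∀ t < s, f t = 1) (t : ℕ) : f t = 1 := by
  induction t using Nat.strong_induction_on with
  | _ t ih =>
    by_cases hts : t < s
    · exact h t hts
    · have e : t - s + s = t := by omega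
      have h1 := hf s (t - s)
      rwa [iterate_fwdRatio_eq s (t - s) (fun u hu => ih u (by omega)), e, zero_add, hs,
        mem_bot] at h1

/-- Polynomial sequences of each level form a group, and commutators add levels. -/
theorem isPolySeq_group [Finite G] (hF : Antitone F) (hcomm : ∀ m n, ⁅F m, F n⁆ ≤ F (m + n))
    {s : ℕ} (hs : F s = ⊥) (d : ℕ) :
    (∀ g h, IsPolySeq F d g → IsPolySeq F d h → IsPolySeq F d (g * h)) ∧
      (∀ g, IsPolySeq F d g → IsPolySeq F d g⁻¹) ∧
      ∀ m n g h, m + n = d → IsPolySeq F m g → IsPolySeq F n h → IsPolySeq F d ⁅g, h⁆ := by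
  obtain ⟨e, he⟩ : ∃ e, s ≤ d + e := ⟨s, by omega⟩
  induction e generalizing d with
  | zero =>
    refine ⟨fun g h hg hh => ?_, fun g hg => ?_, fun m n g h hmn hg hh => ?_⟩
    · rw [hg.eq_one hF hs he, hh.eq_one hF hs he, one_mul]
      exact isPolySeq_one d
    · rw [hg.eq_one hF hs he, inv_one]
      exact isPolySeq_one d
    · have : ⁅g, h⁆ = 1 := by
        funext t
        have h1 := hcomm m n (commutator_mem_commutator (hg 0 t) (hh 0 t))
        have h2 := hF (show s ≤ m + n by omega) h1
        rwa [hs, mem_bot] at h2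
      rw [this]
      exact isPolySeq_one d
  | succ e ih =>
    obtain ⟨hmul, hinv, hbr⟩ := ih (d + 1) (by omega)
    have hconj : ∀ g v, IsPolySeq F 0 g → IsPolySeq F (d + 1) v →
        IsPolySeq F (d + 1) (g * v * g⁻¹) := by
      intro g v hg hv
      have := hmul _ _ (hbr 0 (d + 1) g v (by omega) hg hv) hv
      rwa [commutatorElement_def, inv_mul_cancel_right] at this
    have hconj' : ∀ g v, IsPolySeq F 0 g → IsPolySeq F (d + 1) v →
        IsPolySeq F (d + 1) (g⁻¹ * v * g) := by
      intro g v hg hv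
      have hpow : ∀ n : ℕ, IsPolySeq F (d + 1) (g ^ n * v * (g ^ n)⁻¹) := by
        intro n
        induction n with
        | zero => simpa using hv
        | succ n ihn =>
          have := hconj g _ hg ihn
          convert this using 1
          rw [pow_succ']
          group
      have hginv : g ^ (Nat.card G - 1) = g⁻¹ := by
        rw [eq_inv_iff_mul_eq_one, ← pow_succ, Nat.sub_add_cancel Nat.card_pos]
        funext t
        exact pow_card_eq_one'
      have := hpow (Nat.card G - 1)
      rwa [hginv, inv_inv] at this
    refine ⟨fun g h hg hh => ?_, fun g hg => ?_, fun m n g h hmn hg hh => ?_⟩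
    · refine isPolySeq_iff.2 ⟨fun t => mul_mem (hg 0 t) (hh 0 t), ?_⟩
      have := hmul _ _ (hconj' h _ (hh.mono hF d.zero_le) (isPolySeq_iff.1 hg).2)
        (isPolySeq_iff.1 hh).2
      convert this using 1
      funext t
      simp only [fwdRatio, Pi.mul_apply, Pi.inv_apply]
      group
    · refine isPolySeq_iff.2 ⟨fun t => inv_mem (hg 0 t), ?_⟩
      have := hconj g _ (hg.mono hF d.zero_le) (hinv _ (isPolySeq_iff.1 hg).2)
      convert this using 1
      funext t
      simp only [fwdRatio, Pi.mul_apply, Pi.inv_apply]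
      group
    · subst hmn
      refine isPolySeq_iff.2
        ⟨fun t => hcomm m n (commutator_mem_commutator (hg 0 t) (hh 0 t)), ?_⟩
      have ha := (isPolySeq_iff.1 hg).2
      have hb := (isPolySeq_iff.1 hh).2
      have hg0 := hg.mono hF m.zero_le
      have hh0 := hh.mono hF n.zero_le
      have hah := hbr _ _ _ _ (by omega) ha hh
      have hab := hbr _ _ _ _ (by omega) ha (hb.mono hF n.le_succ)
      have hgb := hbr _ _ _ _ (by omega) hg hb
      have hleft := hconj h _ hh0 (hconj g _ hg0 (hmul _ _ (hconj' h _ hh0 hah) hab))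
      convert hmul _ _ hleft (hconj h _ hh0 hgb) using 1
      funext t
      simp only [fwdRatio, Pi.mul_apply, Pi.inv_apply, commutatorElement_def]
      group

theorem IsPolySeq.eval_eq_one [Finite G] (hF : Antitone F)
    (hcomm : ∀ m n, ⁅F m, F n⁆ ≤ F (m + n)) {s : ℕ} (hs : F s = ⊥) {q j : ℕ} {f : ℕ → G}
    (hf : IsPolySeq F 0 f) (hj : ∀ t < j, f t = 1)
    (hq : ∀ l, j ≤ l → l < s → ∀ c ∈ F l, c ^ q.choose l = 1) : f q = 1 := by
  obtain ⟨e, he⟩ : ∃ e, s ≤ j + e := ⟨s, by omega⟩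
  induction e generalizing j f with
  | zero => exact hf.eq_one_of_forall_lt hs (fun t ht => hj t (by omega)) q
  | succ e ih =>
    by_cases hsj : s ≤ j
    · exact hf.eq_one_of_forall_lt hs (fun t ht => hj t (by omega)) q
    obtain ⟨hmul, hinv, -⟩ := isPolySeq_group hF hcomm hs 0
    have hc : f j ∈ F j := by
      have := hf j 0
      rwa [iterate_fwdRatio_eq j 0 (fun u hu => hj u (by omega)), zero_add] at this
    have hf' : IsPolySeq F 0 (f * (fun t => f j ^ t.choose j)⁻¹) :=
      hmul _ _ hf (hinv _ (isPolySeq_pow_choose hF j 0 (by rwa [zero_add])))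
    have key := ih hf' (j := j + 1) (fun t ht => ?_) (fun l hl => hq l (by omega)) (by omega)
    · simpa [hq j le_rfl (by omega) _ hc] using key
    · rcases Nat.lt_succ_iff_lt_or_eq.1 ht with ht | rfl
      · simp [hj t ht, Nat.choose_eq_zero_of_lt ht]
      · simp

end PolynomialSequences

section LowerCentral

variable {G : Type*} [Group G]

theorem gammaSub_mono {H K : Subgroup G} (h : H ≤ K) (n : ℕ) : gammaSub H n ≤ gammaSub K n := by
  induction n with
  | zero => exact h
  | succ n ih => exact commutator_mono ih h

theorem gammaSub_succ_le (K : Subgroup G) (n : ℕ) : gammaSub K (n + 1) ≤ gammaSub K n := by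
  induction n with
  | zero => exact K.commutator_le_self
  | succ n ih => exact commutator_mono ih le_rfl

theorem gammaSub_antitone (K : Subgroup G) : Antitone (gammaSub K) :=
  antitone_nat_of_succ_le (gammaSub_succ_le K)

theorem map_gammaSub {G' : Type*} [Group G'] (f : G →* G') (K : Subgroup G) (n : ℕ) :
    (gammaSub K n).map f = gammaSub (K.map f) n := by
  induction n with
  | zero => rfl
  | succ n ih => rw [gammaSub, gammaSub, map_commutator, ih]

theorem gammaSub_normal (K : Subgroup G) [K.Normal] (n : ℕ) : (gammaSub K n).Normal := by
  induction n with
  | zero => assumption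
  | succ n ih => exact commutator_normal _ _

/-- The three subgroups lemma modulo a normal subgroup. -/
theorem commutator_commutator_le_of_rotate {A B C M : Subgroup G} [M.Normal]
    (h₁ : ⁅⁅B, C⁆, A⁆ ≤ M) (h₂ : ⁅⁅C, A⁆, B⁆ ≤ M) : ⁅⁅A, B⁆, C⁆ ≤ M := by
  have key : ∀ X : Subgroup G, X ≤ M ↔ X.map (QuotientGroup.mk' M) = ⊥ := by
    intro X
    rw [Subgroup.map_eq_bot_iff, QuotientGroup.ker_mk']
  rw [key] at h₁ h₂ ⊢
  simp only [map_commutator] at h₁ h₂ ⊢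
  exact commutator_commutator_eq_bot_of_rotate h₁ h₂

theorem commutator_gammaSub_top_le (m n : ℕ) :
    ⁅gammaSub (⊤ : Subgroup G) m, gammaSub (⊤ : Subgroup G) n⁆ ≤
      gammaSub (⊤ : Subgroup G) (m + n + 1) := by
  have hnormal := gammaSub_normal (⊤ : Subgroup G)
  induction m generalizing n with
  | zero => rw [commutator_comm, zero_add]; exact le_rfl
  | succ m ih =>
    refine commutator_commutator_le_of_rotate ?_ ?_
    · rw [commutator_comm, commutator_comm ⊤]
      exact (ih (n + 1)).trans (gammaSub_antitone _ (by omega))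
    · rw [commutator_comm (gammaSub ⊤ n)]
      exact (commutator_mono (ih n) le_rfl).trans (gammaSub_antitone _ (by omega) :
        gammaSub ⊤ (m + n + 1 + 1) ≤ _)

theorem commutator_gammaSub_le (K : Subgroup G) (m n : ℕ) :
    ⁅gammaSub K m, gammaSub K n⁆ ≤ gammaSub K (m + n + 1) := by
  have h : ∀ n, gammaSub K n = (gammaSub (⊤ : Subgroup K) n).map K.subtype := by
    intro n
    rw [map_gammaSub, ← MonoidHom.range_eq_map, range_subtype]
  rw [h m, h n, h, ← map_commutator]
  exact map_mono (commutator_gammaSub_top_le m n)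

theorem commutator_gammaSub_gammaSub_top_le (N : Subgroup G) [N.Normal] (m j : ℕ) :
    ⁅gammaSub N m, gammaSub (⊤ : Subgroup G) j⁆ ≤ ⁅N, gammaSub (⊤ : Subgroup G) (m + j)⁆ := by
  have hnormal := gammaSub_normal (⊤ : Subgroup G)
  induction m generalizing j with
  | zero => rw [zero_add]; exact le_rfl
  | succ m ih =>
    refine commutator_commutator_le_of_rotate ?_ ?_
    · rw [commutator_comm]
      have h1 : ⁅N, gammaSub (⊤ : Subgroup G) j⁆ ≤ gammaSub (⊤ : Subgroup G) (j + 1) := by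
        rw [commutator_comm]
        exact commutator_mono le_rfl le_top
      have := (commutator_mono le_rfl h1).trans (ih (j + 1))
      rwa [show m + (j + 1) = m + 1 + j by omega] at this
    · rw [commutator_comm]
      refine commutator_mono le_rfl ?_
      refine (commutator_mono le_rfl (gammaSub_mono le_top m)).trans ?_
      refine (commutator_gammaSub_top_le j m).trans (gammaSub_antitone _ (by omega))

theorem commutator_closure_le {S : Set G} {M : Subgroup G}
    (hM : ∀ g ∈ closure S, ∀ m ∈ M, g * m * g⁻¹ ∈ M) (hS : ∀ a ∈ S, ∀ b ∈ S, ⁅a, b⁆ ∈ M) :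
    ⁅closure S, closure S⁆ ≤ M := by
  have hleft : ∀ b ∈ closure S, (∀ a ∈ S, ⁅a, b⁆ ∈ M) → ∀ a ∈ closure S, ⁅a, b⁆ ∈ M := by
    intro b hb h a ha
    induction ha using closure_induction with
    | mem x hx => exact h x hx
    | one => rw [commutatorElement_one_left]; exact one_mem _
    | mul x y hx hy ihx ihy =>
      have : ⁅x * y, b⁆ = x * ⁅y, b⁆ * x⁻¹ * ⁅x, b⁆ := by
        simp only [commutatorElement_def]; group
      rw [this]
      exact mul_mem (hM x hx _ ihy) ihx
    | inv x hx ih =>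
      have : ⁅x⁻¹, b⁆ = x⁻¹ * ⁅x, b⁆⁻¹ * x⁻¹⁻¹ := by
        simp only [commutatorElement_def]; group
      rw [this]
      exact hM _ (inv_mem hx) _ (inv_mem ih)
  have hswap : ∀ a b : G, ⁅a, b⁆ ∈ M → ⁅b, a⁆ ∈ M := fun a b h => by
    rw [← commutatorElement_inv]; exact inv_mem h
  refine commutator_le.2 fun a ha b hb => hleft b hb (fun x hx => ?_) a ha
  exact hswap _ _ (hleft x (subset_closure hx) (fun y hy => hS y hy x hx) b hb)

theorem conj_mem_commutator_right {A K : Subgroup G} {g m : G} (hg : g ∈ K) (hm : m ∈ ⁅A, K⁆) :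
    g * m * g⁻¹ ∈ ⁅A, K⁆ :=
  (mem_normalizer_iff.1 (normalizer_commutator_ge_right A K hg) m).1 hm

/-- Adjoining one element to the derived subgroup lowers the nilpotency class. -/
theorem gammaSub_closure_insert_le {K : Subgroup G} {u : G} (hu : u ∈ K) (c : ℕ) :
    gammaSub (closure (insert u (⁅K, K⁆ : Subgroup G))) (c + 1) ≤ gammaSub K (c + 2) := by
  have hle : closure (insert u ((⁅K, K⁆ : Subgroup G) : Set G)) ≤ K := by
    rw [closure_le]
    exact Set.insert_subset hu K.commutator_le_self
  induction c with
  | zero =>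
    refine commutator_closure_le (fun g hg m hm => conj_mem_commutator_right (hle hg) hm) ?_
    rintro a (rfl | ha) b (rfl | hb)
    · rw [commutatorElement_self]; exact one_mem _
    · rw [← commutatorElement_inv]
      exact inv_mem (commutator_mem_commutator hb hu)
    · exact commutator_mem_commutator ha hu
    · exact commutator_mem_commutator ha (K.commutator_le_self hb)
  | succ c ih => exact commutator_mono ih hle

end LowerCentral

section Regular

variable {G : Type*} [Group G]

/-- In nilpotency class at most `c`, if `q` divides `q.choose j` for `2 ≤ j ≤ c` and the derived
subgroup has exponent dividing `q`, then the `q`-th power map is multiplicative. -/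
theorem mul_pow_of_commutator_pow_eq_one [Finite G] {K : Subgroup G} {c q : ℕ}
    (hK : gammaSub K c = ⊥) (hq : ∀ j, 2 ≤ j → j ≤ c → q ∣ q.choose j)
    (hexp : ∀ w ∈ ⁅K, K⁆, w ^ q = 1) {x y : G} (hx : x ∈ K) (hy : y ∈ K) :
    (x * y) ^ q = x ^ q * y ^ q := by
  let F : ℕ → Subgroup G := fun n => gammaSub K (n - 1)
  have hF : Antitone F := fun m n hmn => gammaSub_antitone K (by omega)
  have hcomm : ∀ m n, ⁅F m, F n⁆ ≤ F (m + n) := fun m n =>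
    (commutator_gammaSub_le K _ _).trans (gammaSub_antitone K (by omega))
  have hs : F (c + 1) = ⊥ := hK
  obtain ⟨hmul, hinv, -⟩ := isPolySeq_group hF hcomm hs 0
  have hpow : ∀ z ∈ K, IsPolySeq F 0 (fun t => z ^ t) := fun z hz => by
    simpa using isPolySeq_pow_choose hF 1 0 (show z ∈ F (0 + 1) from hz)
  have hf := hmul _ _ (hinv _ (hmul _ _ (hpow x hx) (hpow y hy))) (hpow _ (mul_mem hx hy))
  have key := hf.eval_eq_one hF hcomm hs (q := q) (j := 2) ?_ ?_
  · exact (inv_mul_eq_one.1 key).symm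
  · intro t ht
    interval_cases t <;> simp
  · intro l hl hlc w hw
    obtain ⟨r, hr⟩ := hq l hl (by omega)
    have hw' : w ∈ ⁅K, K⁆ := gammaSub_antitone K (show 1 ≤ l - 1 by omega) hw
    rw [hr, pow_mul, hexp w hw', one_pow]

/-- On subgroups of class at most `c`, two elements have the same `q`-th power exactly when the
`q`-th power of their quotient is trivial. -/
def PowRegular (G : Type*) [Group G] (q c : ℕ) : Prop :=
  ∀ K : Subgroup G, gammaSub K c = ⊥ → ∀ x ∈ K, ∀ y ∈ K, x ^ q = y ^ q ↔ (x⁻¹ * y) ^ q = 1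

theorem PowRegular.commute_pow_iff {q c : ℕ} (h : PowRegular G q (c + 1)) {K : Subgroup G}
    (hK : gammaSub K (c + 2) = ⊥) {x y : G} (hx : x ∈ K) (hy : y ∈ K) :
    Commute (x ^ q) y ↔ ⁅x, y⁆ ^ q = 1 := by
  have hL := le_bot_iff.1 ((gammaSub_closure_insert_le hx c).trans hK.le)
  have hxL : x ∈ closure (insert x ((⁅K, K⁆ : Subgroup G) : Set G)) :=
    subset_closure (Set.mem_insert _ _)
  have hcL : ⁅x, y⁆ ∈ closure (insert x ((⁅K, K⁆ : Subgroup G) : Set G)) :=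
    subset_closure (Set.mem_insert_of_mem _ (commutator_mem_commutator hx hy))
  have hconj : x⁻¹ * ⁅x, y⁆ = y * x⁻¹ * y⁻¹ := by
    simp only [commutatorElement_def]; group
  have key := h _ hL x⁻¹ (inv_mem hxL) (x⁻¹ * ⁅x, y⁆) (mul_mem (inv_mem hxL) hcL)
  rw [inv_inv, mul_inv_cancel_left, hconj, conj_pow, eq_mul_inv_iff_mul_eq, inv_pow] at key
  rw [← key, ← Commute.inv_left_iff]
  rfl

theorem PowRegular.commutator_pow_eq_one {q c : ℕ} (h : PowRegular G q (c + 1)) {x y : G}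
    (hK : gammaSub (closure {x, y}) (c + 2) = ⊥) (hxy : ⁅x, y⁆ ^ q = 1) :
    ∀ w ∈ ⁅closure {x, y}, closure {x, y}⁆, w ^ q = 1 := by
  set K := closure ({x, y} : Set G)
  have hx : x ∈ K := subset_closure (by simp)
  have hy : y ∈ K := subset_closure (by simp)
  have hD : gammaSub ⁅K, K⁆ (c + 1) = ⊥ := by
    refine le_bot_iff.1 (((gammaSub_mono ?_ _).trans (gammaSub_closure_insert_le hx c)).trans
      hK.le)
    exact fun w hw => subset_closure (Set.mem_insert_of_mem _ hw)
  let Ω : Subgroup G :=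
    { carrier := {w | w ∈ ⁅K, K⁆ ∧ w ^ q = 1}
      one_mem' := ⟨one_mem _, one_pow _⟩
      mul_mem' := by
        rintro a b ⟨ha, haq⟩ ⟨hb, hbq⟩
        refine ⟨mul_mem ha hb, ?_⟩
        rw [← (h _ hD a ha (a * b) (mul_mem ha hb)).2 (by rwa [inv_mul_cancel_left]), haq]
      inv_mem' := by
        rintro a ⟨ha, haq⟩
        exact ⟨inv_mem ha, by rw [inv_pow, haq, inv_one]⟩ }
  have hΩ : ⁅K, K⁆ ≤ Ω := by
    refine commutator_closure_le ?_ ?_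
    · rintro g hg m ⟨hm, hmq⟩
      exact ⟨conj_mem_commutator_right hg hm, by rw [conj_pow, hmq]; simp⟩
    · have hmem : ⁅x, y⁆ ∈ Ω := ⟨commutator_mem_commutator hx hy, hxy⟩
      rintro a (rfl | rfl) b (rfl | rfl)
      · rw [commutatorElement_self]; exact one_mem _
      · exact hmem
      · rw [← commutatorElement_inv]; exact inv_mem hmem
      · rw [commutatorElement_self]; exact one_mem _
  exact fun w hw => (hΩ hw).2

theorem powRegular [Finite G] {q : ℕ} (c : ℕ)
    (hq : ∀ j, 2 ≤ j → j ≤ c + 1 → q ∣ q.choose j) : PowRegular G q (c + 1) := by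
  induction c with
  | zero =>
    intro K hK x hx y hy
    have hxy : Commute x⁻¹ y := by
      rw [← commutatorElement_eq_one_iff_commute, ← mem_bot, ← hK]
      exact commutator_mem_commutator (inv_mem hx) hy
    rw [hxy.mul_pow, inv_pow, inv_mul_eq_one]
  | succ c ih =>
    have hreg := ih fun j h2 hj => hq j h2 (by omega)
    have hmul : ∀ x y : G, gammaSub (closure {x, y}) (c + 2) = ⊥ → Commute (x ^ q) y →
        (x * y) ^ q = x ^ q * y ^ q ∧ (x⁻¹ * y) ^ q = (x ^ q)⁻¹ * y ^ q := by
      intro x y hK hxy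
      have hx : x ∈ closure ({x, y} : Set G) := subset_closure (by simp)
      have hy : y ∈ closure ({x, y} : Set G) := subset_closure (by simp)
      have hexp := hreg.commutator_pow_eq_one hK ((hreg.commute_pow_iff hK hx hy).1 hxy)
      refine ⟨mul_pow_of_commutator_pow_eq_one hK hq hexp hx hy, ?_⟩
      rw [mul_pow_of_commutator_pow_eq_one hK hq hexp (inv_mem hx) hy, inv_pow]
    intro K hK x hx y hy
    have hsub : ∀ a ∈ K, ∀ b ∈ K, gammaSub (closure {a, b}) (c + 2) = ⊥ := fun a ha b hb =>
      le_bot_iff.1 ((gammaSub_mono ((closure_le K).2 (Set.pair_subset ha hb)) _).trans hK.le)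
    constructor
    · intro hxy
      rw [(hmul x y (hsub x hx y hy) (hxy ▸ (Commute.refl y).pow_left q)).2, hxy, inv_mul_cancel]
    · intro hz
      have hzK : x⁻¹ * y ∈ K := mul_mem (inv_mem hx) hy
      have hcomm : Commute (((x⁻¹ * y)⁻¹) ^ q) x⁻¹ := by
        rw [inv_pow, hz, inv_one]
        exact Commute.one_left _
      have := (hmul _ _ (hsub _ (inv_mem hzK) _ (inv_mem hx)) hcomm).1
      rw [inv_pow, hz, inv_one, one_mul, mul_inv_rev, inv_inv, mul_inv_cancel_right,
        inv_pow, inv_pow, inv_inj] at this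
      exact this.symm

end Regular

theorem prime_pow_dvd_choose {p i j : ℕ} (hp : p.Prime) (hj : 1 ≤ j) (hjp : j < p) :
    p ^ i ∣ (p ^ i).choose j := by
  have hcop : (p ^ i).Coprime j :=
    Nat.Coprime.pow_left i ((Nat.Prime.coprime_iff_not_dvd hp).2 (Nat.not_dvd_of_pos_of_lt hj hjp))
  obtain ⟨l, rfl⟩ : ∃ l, j = l + 1 := ⟨j - 1, by omega⟩
  obtain ⟨n, hn⟩ : ∃ n, p ^ i = n + 1 :=
    ⟨p ^ i - 1, (Nat.sub_add_cancel (pow_pos hp.pos i)).symm⟩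
  refine hcop.dvd_of_dvd_mul_right ?_
  rw [hn, ← Nat.add_one_mul_choose_eq]
  exact dvd_mul_right _ _

/-- In a finite group of class at most `p`, `n ^ p ^ i` commutes with `g` exactly when `g ^ p ^ i`
commutes with `n`. -/
theorem commute_prime_pow_comm {G : Type*} [Group G] [Finite G] {p i : ℕ} (hp : p.Prime)
    (hG : gammaSub (⊤ : Subgroup G) p = ⊥) (n g : G) :
    Commute (n ^ p ^ i) g ↔ Commute (g ^ p ^ i) n := by
  obtain ⟨c, rfl⟩ : ∃ c, p = c + 2 := ⟨p - 2, by have := hp.two_le; omega⟩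
  have hreg : PowRegular G ((c + 2) ^ i) (c + 1) :=
    powRegular c fun j h2 hj => prime_pow_dvd_choose hp (by omega) (by omega)
  rw [hreg.commute_pow_iff hG (mem_top n) (mem_top g),
    hreg.commute_pow_iff hG (mem_top g) (mem_top n), ← commutatorElement_inv, inv_pow, inv_eq_one]

theorem powSubgroup_normal {G : Type*} [Group G] (H : Subgroup G) [hH : H.Normal] (n : ℕ) :
    (powSubgroup H n).Normal := by
  refine ⟨fun x hx g => ?_⟩
  have hle : powSubgroup H n ≤ (powSubgroup H n).comap (MulAut.conj g).toMonoidHom := by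
    refine (closure_le _).2 ?_
    rintro _ ⟨h, hh, rfl⟩
    exact subset_closure ⟨g * h * g⁻¹, hH.conj_mem h hh g, by simp [conj_pow]⟩
  exact hle hx

theorem omegaI_normal {G : Type*} [Group G] (p i k : ℕ) (H : Subgroup G) [H.Normal] :
    (omegaI p i k H).Normal := by
  have := powSubgroup_normal H (p ^ i)
  have := gammaSub_normal H (k - 1)
  exact sup_normal _ _

/-- **Lemma 1(i).** For `p` odd and `k ≤ p - 1`, the word `ω = x^{p^i}[y₁,…,y_k]` is
interchangeable in any finite `p`-group `G`: for every normal `N ⊴ G`,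
`[ω(N),G] ≤ [N,ω(G)] ⬝ [ω(G),G]^p ⬝ [ω(G),G,G]`. -/
theorem omegaI_interchangeable {G : Type*} [Group G] [Finite G] {p i k : ℕ}
    (hp : p.Prime) (hodd : Odd p) (hk : k ≤ p - 1) (hG : IsPGroup p G)
    (N : Subgroup G) (hN : N.Normal) :
    ⁅omegaI p i k N, (⊤ : Subgroup G)⁆ ≤
      ⁅N, omegaI p i k (⊤ : Subgroup G)⁆ ⊔
        powSubgroup ⁅omegaI p i k (⊤ : Subgroup G), (⊤ : Subgroup G)⁆ p ⊔
        ⁅⁅omegaI p i k (⊤ : Subgroup G), (⊤ : Subgroup G)⁆, (⊤ : Subgroup G)⁆ := by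
  have hWn : (omegaI p i k (⊤ : Subgroup G)).Normal := omegaI_normal p i k ⊤
  set W := omegaI p i k (⊤ : Subgroup G)
  have hγW : gammaSub (⊤ : Subgroup G) (k - 1) ≤ W := le_sup_right
  let R : Subgroup G := ⁅N, W⁆ ⊔ ⁅⁅W, (⊤ : Subgroup G)⁆, (⊤ : Subgroup G)⁆
  have hR : R.Normal := sup_normal _ _
  have hle : R ≤ ⁅N, W⁆ ⊔ powSubgroup ⁅W, (⊤ : Subgroup G)⁆ p ⊔
      ⁅⁅W, (⊤ : Subgroup G)⁆, (⊤ : Subgroup G)⁆ :=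
    sup_le_sup_right le_sup_left _
  refine le_trans ?_ hle
  have hclass : gammaSub (⊤ : Subgroup (G ⧸ R)) p = ⊥ := by
    have hmap : (⊤ : Subgroup (G ⧸ R)) = (⊤ : Subgroup G).map (QuotientGroup.mk' R) :=
      (map_top_of_surjective _ (QuotientGroup.mk'_surjective R)).symm
    rw [hmap, ← map_gammaSub, Subgroup.map_eq_bot_iff, QuotientGroup.ker_mk']
    have hp2 := hp.two_le
    calc gammaSub (⊤ : Subgroup G) p ≤ gammaSub (⊤ : Subgroup G) (k - 1 + 2) :=
          gammaSub_antitone _ (by omega)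
      _ ≤ ⁅⁅W, (⊤ : Subgroup G)⁆, (⊤ : Subgroup G)⁆ :=
          commutator_mono (commutator_mono hγW le_rfl) le_rfl
      _ ≤ R := le_sup_right
  have hmem : ∀ a b : G, ⁅a, b⁆ ∈ R ↔ Commute (a : G ⧸ R) (b : G ⧸ R) := fun a b => by
    rw [← commutatorElement_eq_one_iff_commute, ← QuotientGroup.eq_one_iff]
    rfl
  have hcenter : omegaI p i k N ≤ (center (G ⧸ R)).comap (QuotientGroup.mk' R) := by
    refine sup_le ((closure_le _).2 ?_) fun x hx => mem_center_iff.2 fun y => ?_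
    · rintro _ ⟨n, hn, rfl⟩
      refine mem_center_iff.2 fun y => ?_
      obtain ⟨g, rfl⟩ := QuotientGroup.mk_surjective y
      have hgW : g ^ p ^ i ∈ W :=
        mem_sup_left (subset_closure ⟨g, mem_top g, rfl⟩)
      have hng : Commute (n : G ⧸ R) ((g ^ p ^ i : G) : G ⧸ R) :=
        (hmem _ _).1 (mem_sup_left (commutator_mem_commutator hn hgW))
      exact ((commute_prime_pow_comm hp hclass (n : G ⧸ R) (g : G ⧸ R)).2 hng.symm).symm
    · obtain ⟨g, rfl⟩ := QuotientGroup.mk_surjective y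
      refine ((hmem x g).1 (mem_sup_left ?_)).symm
      exact commutator_mono le_rfl hγW
        (commutator_gammaSub_gammaSub_top_le N (k - 1) 0 (commutator_mem_commutator hx (mem_top g)))
  refine commutator_le.2 fun x hx g _ => (hmem x g).2 ?_
  exact (mem_center_iff.1 (hcenter hx) (g : G ⧸ R)).symm
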